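/- The chart domains centered at the diagonal elements cover the conjugacy class: let Λ be a diagonal n×n complex matrix with pairwise distinct diagonal entries. For every X ∈ {g·Λ·g⁻¹ : g ∈ GL_n(ℂ)} there exist a permutation matrix P, a matrix k ∈ C, and l ∈ L such that X = (l·k)⁻¹·(P·Λ·P⁻¹)·(l·k). -/

import Mathlib

open Matrix

/-- `L`: lower unitriangular `n × n` complex matrices. -/
def IsLowerUni {n : ℕ} (l : Matrix (Fin n) (Fin n) ℂ) : Prop :=
  (∀ i, l i i = 1) ∧ ∀ i j : Fin n, i < j → l i j = 0

/-- `U`: upper triangular `n × n` complex matrices with strictly positive real diagonal. -/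
def IsUpperPos {n : ℕ} (u : Matrix (Fin n) (Fin n) ℂ) : Prop :=
  (∀ i, 0 < (u i i).re ∧ (u i i).im = 0) ∧ ∀ i j : Fin n, j < i → u i j = 0

/-- A matrix is unitary if `k* · k = 1`. -/
def IsUnitaryMat {n : ℕ} (k : Matrix (Fin n) (Fin n) ℂ) : Prop :=
  kᴴ * k = 1

/-- The leading principal minor of order `m`: the determinant of the top-left
`m × m` submatrix. -/
def leadMinor {n : ℕ} (A : Matrix (Fin n) (Fin n) ℂ) (m : ℕ) (h : m ≤ n) : ℂ :=
  (A.submatrix (Fin.castLE h) (Fin.castLE h)).det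


/-- `C`: unitary matrices admitting an `LU` factorization with `l ∈ L`, `u ∈ U`. -/
def InBigCell {n : ℕ} (k : Matrix (Fin n) (Fin n) ℂ) : Prop :=
  IsUnitaryMat k ∧ ∃ l u : Matrix (Fin n) (Fin n) ℂ, IsLowerUni l ∧ IsUpperPos u ∧ k = l * u

/-- The permutation matrix of a permutation `σ` of the standard basis. -/
def permMat {n : ℕ} (σ : Equiv.Perm (Fin n)) : Matrix (Fin n) (Fin n) ℂ :=
  Matrix.of fun i j => if σ j = i then 1 else 0


/-- Pivoted LU factorization, valid for every square matrix. -/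
theorem exists_plu : ∀ (n : ℕ) (A : Matrix (Fin n) (Fin n) ℂ),
    ∃ (σ : Equiv.Perm (Fin n)) (l u : Matrix (Fin n) (Fin n) ℂ),
      IsLowerUni l ∧ (∀ i j : Fin n, j < i → u i j = 0) ∧ A.submatrix σ id = l * u := by
  intro n
  induction n with
  | zero =>
    intro A
    exact ⟨1, 1, 1, ⟨fun i => i.elim0, fun i => i.elim0⟩, fun i => i.elim0, by ext i; exact i.elim0⟩
  | succ n ih =>
    intro A
    obtain ⟨p, c, hc⟩ : ∃ (p : Fin (n+1)) (c : Fin (n+1) → ℂ), ∀ j, A j 0 = c j * A p 0 := by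
      by_cases h : ∃ p, A p 0 ≠ 0
      · obtain ⟨p, hp⟩ := h
        exact ⟨p, fun j => A j 0 / A p 0, fun j => by field_simp⟩
      · push Not at h
        exact ⟨0, 0, fun j => by simp [h]⟩
    obtain ⟨σ, l, u, hl, hu, hlu⟩ := ih (Matrix.of fun j k =>
      A (Equiv.swap 0 p j.succ) k.succ - c (Equiv.swap 0 p j.succ) * A p k.succ)
    refine ⟨Equiv.Perm.decomposeFin.symm (p, σ),
      Matrix.of (Fin.cases (Fin.cases 1 (fun _ => 0))
        (fun j => Fin.cases (c (Equiv.swap 0 p (σ j).succ)) (l j))),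
      Matrix.of (Fin.cases (Fin.cases (A p 0) (fun k => A p k.succ))
        (fun j => Fin.cases 0 (u j))), ⟨?_, ?_⟩, ?_, ?_⟩
    · intro i
      cases i using Fin.cases with
      | zero => rfl
      | succ i => exact hl.1 i
    · intro i j hij
      cases i using Fin.cases with
      | zero =>
        cases j using Fin.cases with
        | zero => simp at hij
        | succ j => rfl
      | succ i =>
        cases j using Fin.cases with
        | zero => simp at hij
        | succ j => exact hl.2 i j (by simpa using hij)
    · intro i j hij
      cases i using Fin.cases with
      | zero => simp at hij
      | succ i =>
        cases j using Fin.cases with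
        | zero => rfl
        | succ j => exact hu i j (by simpa using hij)
    · ext i j
      rw [Matrix.mul_apply, Fin.sum_univ_succ]
      cases i using Fin.cases with
      | zero =>
        cases j using Fin.cases with
        | zero => simp
        | succ j => simp
      | succ i =>
        cases j using Fin.cases with
        | zero =>
          simp only [submatrix_apply, Equiv.Perm.decomposeFin_symm_apply_succ, id, of_apply,
            Fin.cases_zero, Fin.cases_succ, mul_zero, Finset.sum_const_zero, add_zero]
          exact hc _
        | succ j =>
          have := congrFun (congrFun hlu i) j
          rw [Matrix.mul_apply] at this
          simp only [submatrix_apply, Equiv.Perm.decomposeFin_symm_apply_succ, id, of_apply,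
            Fin.cases_zero, Fin.cases_succ] at this ⊢
          rw [← this]; ring

theorem IsLowerUni.mul {n : ℕ} {a b : Matrix (Fin n) (Fin n) ℂ} (ha : IsLowerUni a)
    (hb : IsLowerUni b) : IsLowerUni (a * b) := by
  constructor
  · intro i
    rw [Matrix.mul_apply, Finset.sum_eq_single i]
    · rw [ha.1, hb.1, one_mul]
    · intro j _ hj
      rcases lt_or_gt_of_ne hj with h | h
      · rw [hb.2 _ _ h, mul_zero]
      · rw [ha.2 _ _ h, zero_mul]
    · simp
  · intro i j hij
    rw [Matrix.mul_apply]
    refine Finset.sum_eq_zero fun k _ => ?_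
    rcases lt_or_ge i k with h | h
    · rw [ha.2 _ _ h, zero_mul]
    · rw [hb.2 _ _ (h.trans_lt hij), mul_zero]

theorem IsLowerUni.det {n : ℕ} {a : Matrix (Fin n) (Fin n) ℂ} (ha : IsLowerUni a) :
    a.det = 1 := by
  rw [Matrix.det_of_isLowerTriangular a (fun i j h => ha.2 i j h)]
  simp [ha.1]

theorem IsLowerUni.inv {n : ℕ} {a : Matrix (Fin n) (Fin n) ℂ} (ha : IsLowerUni a) :
    IsLowerUni a⁻¹ := by
  have hu : IsUnit a.det := by rw [ha.det]; exact isUnit_one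
  let _ := Matrix.invertibleOfIsUnitDet a hu
  have hbt : Matrix.BlockTriangular a (OrderDual.toDual : Fin n → _) := fun i j h => ha.2 i j h
  have hz : ∀ i j : Fin n, i < j → a⁻¹ i j = 0 := fun i j h =>
    Matrix.blockTriangular_inv_of_blockTriangular hbt h
  refine ⟨fun i => ?_, hz⟩
  have h1 := congrFun (congrFun (Matrix.mul_nonsing_inv a hu) i) i
  rw [Matrix.mul_apply, Finset.sum_eq_single i] at h1
  · simpa [ha.1] using h1
  · intro j _ hj
    rcases lt_or_gt_of_ne hj with h | h
    · rw [hz _ _ h, mul_zero]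
    · rw [ha.2 _ _ h, zero_mul]
  · simp

theorem IsLowerUni.conj {n : ℕ} {a : Matrix (Fin n) (Fin n) ℂ} (ha : IsLowerUni a)
    (t : Fin n → ℂ) (ht : ∀ i, t i ≠ 0) :
    IsLowerUni (diagonal t * a * diagonal (fun i => (t i)⁻¹)) := by
  constructor
  · intro i
    simp [Matrix.mul_diagonal, Matrix.diagonal_mul, ha.1, ht]
  · intro i j h
    simp [Matrix.mul_diagonal, Matrix.diagonal_mul, ha.2 i j h]

theorem diag_inv_mul {n : ℕ} (t : Fin n → ℂ) (ht : ∀ i, t i ≠ 0) :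
    diagonal (fun i => (t i)⁻¹) * diagonal t = 1 := by
  rw [Matrix.diagonal_mul_diagonal, ← Matrix.diagonal_one]
  congr 1; ext i; exact inv_mul_cancel₀ (ht i)

/-- Row orthogonalization. -/
theorem exists_orth {n : ℕ} (A : Matrix (Fin n) (Fin n) ℂ) (hA : A.det ≠ 0) :
    ∃ (l G : Matrix (Fin n) (Fin n) ℂ) (t : Fin n → ℝ), IsLowerUni l ∧ A = l * G ∧
      (∀ i, 0 < t i) ∧
      IsUnitaryMat (diagonal (fun i => (t i : ℂ)) * G) := by
  let f : Fin n → EuclideanSpace ℂ (Fin n) := fun i => WithLp.toLp 2 (A i)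
  let g := InnerProductSpace.gramSchmidt ℂ f
  let G : Matrix (Fin n) (Fin n) ℂ := Matrix.of fun i j => g i j
  let l : Matrix (Fin n) (Fin n) ℂ := Matrix.of fun i j =>
    if j < i then inner ℂ (g j) (f i) / (‖g j‖ : ℂ) ^ 2 else if i = j then 1 else 0
  have hl : IsLowerUni l := by
    constructor
    · intro i; simp [l]
    · intro i j h; simp [l, h.not_gt, h.ne]
  have hAG : A = l * G := by
    ext i j
    have h := congrArg (fun v : EuclideanSpace ℂ (Fin n) => v j)
      (InnerProductSpace.gramSchmidt_def'' ℂ f i)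
    simp only [PiLp.add_apply, WithLp.ofLp_sum, Finset.sum_apply, PiLp.smul_apply, smul_eq_mul] at h
    rw [Matrix.mul_apply, ← Finset.add_sum_erase _ _ (Finset.mem_univ i)]
    have : A i j = f i j := rfl
    rw [this, h, hl.1, one_mul]
    congr 1
    have hs : Finset.Iio i ⊆ Finset.univ.erase i := by
      intro x hx; simp at hx; simp [hx.ne]
    rw [← Finset.sum_subset hs]
    · refine Finset.sum_congr rfl fun k hk => ?_
      simp only [Finset.mem_Iio] at hk
      simp [l, G, g, hk]
    · intro x hx hx'
      simp only [Finset.mem_erase, Finset.mem_univ, and_true, Finset.mem_Iio, not_lt] at hx hx'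
      rw [hl.2 i x (lt_of_le_of_ne hx' (Ne.symm hx)), zero_mul]
  have hG : G.det ≠ 0 := by
    intro h; apply hA; rw [hAG, Matrix.det_mul, h, mul_zero]
  have hg : ∀ i, g i ≠ 0 := by
    intro i h
    apply hG
    refine Matrix.det_eq_zero_of_row_eq_zero i fun j => ?_
    simp [G, h]
  refine ⟨l, G, fun i => ‖g i‖⁻¹, hl, hAG, fun i => by simpa using hg i, ?_⟩
  unfold IsUnitaryMat
  rw [mul_eq_one_comm]
  ext i j
  have hin : ∑ k, g i k * star (g j k) = inner ℂ (g j) (g i) := by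
    rw [PiLp.inner_apply]; rfl
  rw [Matrix.mul_apply]
  have : ∀ k, (diagonal (fun i => ((‖g i‖⁻¹ : ℝ) : ℂ)) * G) i k *
      (diagonal (fun i => ((‖g i‖⁻¹ : ℝ) : ℂ)) * G)ᴴ k j =
      ((‖g i‖⁻¹ : ℝ) : ℂ) * ((‖g j‖⁻¹ : ℝ) : ℂ) * (g i k * star (g j k)) := by
    intro k
    simp only [conjTranspose_apply, Matrix.diagonal_mul, star_mul', G, of_apply]
    have : star ((‖g j‖⁻¹ : ℝ) : ℂ) = ((‖g j‖⁻¹ : ℝ) : ℂ) := Complex.conj_ofReal _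
    rw [this]; ring
  rw [Finset.sum_congr rfl (fun k _ => this k), ← Finset.mul_sum, hin]
  by_cases hij : i = j
  · subst hij
    rw [inner_self_eq_norm_sq_to_K]
    have : (‖g i‖ : ℂ) ≠ 0 := by simpa using hg i
    simp
    field_simp
  · rw [InnerProductSpace.gramSchmidt_orthogonal ℂ f (Ne.symm hij)]
    simp [hij]

theorem permMat_mul {n : ℕ} (σ : Equiv.Perm (Fin n)) (M : Matrix (Fin n) (Fin n) ℂ) :
    permMat σ⁻¹ * M = M.submatrix σ id := by
  ext i j
  rw [Matrix.mul_apply, Finset.sum_eq_single (σ i)]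
  · simp [permMat]
  · intro k _ hk
    have : σ⁻¹ k ≠ i := by
      rintro rfl; simp at hk
    simp only [permMat, of_apply, if_neg this, zero_mul]
  · simp

theorem permMat_mul_diag {n : ℕ} (σ : Equiv.Perm (Fin n)) (d : Fin n → ℂ) :
    permMat σ⁻¹ * diagonal d = diagonal (fun i => d (σ i)) * permMat σ⁻¹ := by
  rw [permMat_mul]
  ext i j
  simp only [submatrix_apply, id, Matrix.diagonal_mul, permMat, of_apply, diagonal_apply]
  by_cases h : σ i = j
  · subst h; simp
  · have : σ⁻¹ j ≠ i := by
      rintro rfl; simp at h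
    simp only [if_neg h, if_neg this, mul_zero]

theorem permMat_det {n : ℕ} (σ : Equiv.Perm (Fin n)) : IsUnit (permMat σ⁻¹).det := by
  have h : permMat σ⁻¹ * (1 : Matrix (Fin n) (Fin n) ℂ).submatrix (σ⁻¹ : Equiv.Perm (Fin n)) id = 1 := by
    rw [permMat_mul]; ext i j; simp [Matrix.one_apply]
  exact Matrix.isUnit_det_of_right_inverse h

/-- The chart domains centered at diagonal elements cover the conjugacy class: every
element of the conjugacy class of `Λ` lies in a chart centered at some `P·Λ·P⁻¹`
with `P` a permutation matrix. -/
theorem stmt11 (n : ℕ) (hn : 0 < n) (d : Fin n → ℂ) (hd : Function.Injective d)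
    (X : Matrix (Fin n) (Fin n) ℂ)
    (hX : ∃ g : Matrix (Fin n) (Fin n) ℂ, IsUnit g ∧ X = g * Matrix.diagonal d * g⁻¹) :
    ∃ (σ : Equiv.Perm (Fin n)) (k l : Matrix (Fin n) (Fin n) ℂ),
      InBigCell k ∧ IsLowerUni l ∧
        X = (l * k)⁻¹ * (permMat σ * Matrix.diagonal d * (permMat σ)⁻¹) * (l * k) := by
  obtain ⟨g, hg, rfl⟩ := hX
  have hgd : IsUnit g.det := (Matrix.isUnit_iff_isUnit_det g).1 hg
  obtain ⟨σ, l1, u1, hl1, hu1, hlu⟩ := exists_plu n g⁻¹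
  rw [← permMat_mul] at hlu
  have hP := permMat_det σ
  have hgi : IsUnit (g⁻¹).det := Matrix.isUnit_nonsing_inv_det g hgd
  have hu1d : u1.det ≠ 0 := by
    have h := congrArg Matrix.det hlu
    rw [Matrix.det_mul, Matrix.det_mul, hl1.det, one_mul] at h
    rw [← h]
    exact (hP.mul hgi).ne_zero
  have hu1i : ∀ i, u1 i i ≠ 0 := by
    intro i
    rw [Matrix.det_of_isUpperTriangular (fun i j h => hu1 i j h)] at hu1d
    exact Finset.prod_ne_zero_iff.1 hu1d i (Finset.mem_univ i)
  let D : Fin n → ℂ := fun i => (u1 i i)⁻¹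
  have hD : ∀ i, D i ≠ 0 := fun i => inv_ne_zero (hu1i i)
  let A := diagonal D * (permMat σ⁻¹ * g⁻¹)
  have hdd : ∀ t : Fin n → ℂ, (∀ i, t i ≠ 0) → (diagonal t).det ≠ 0 := by
    intro t ht
    rw [Matrix.det_diagonal]
    exact Finset.prod_ne_zero_iff.2 fun i _ => ht i
  have hA : A.det ≠ 0 := by
    simp only [A, Matrix.det_mul]
    exact mul_ne_zero (hdd D hD) (hP.mul hgi).ne_zero
  obtain ⟨l, G, t, hl, hAG, ht, hk⟩ := exists_orth A hA
  let T : Fin n → ℂ := fun i => (t i : ℂ)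
  have hT : ∀ i, T i ≠ 0 := fun i => by simpa [T] using (ht i).ne'
  have hldet : IsUnit l.det := by rw [hl.det]; exact isUnit_one
  have hGA : G = l⁻¹ * A := by
    rw [hAG, ← Matrix.mul_assoc, Matrix.nonsing_inv_mul l hldet, Matrix.one_mul]
  have e1 := diag_inv_mul T hT
  have e2 := diag_inv_mul D hD
  have hlk : (diagonal T * l * diagonal (fun i => (T i)⁻¹)) * (diagonal T * G) =
      diagonal T * A := by
    calc _ = diagonal T * l * (diagonal (fun i => (T i)⁻¹) * diagonal T) * G := by
          simp only [Matrix.mul_assoc]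
      _ = _ := by rw [e1, hAG]; simp only [Matrix.mul_assoc, Matrix.one_mul]
  refine ⟨σ⁻¹, diagonal T * G, diagonal T * l * diagonal (fun i => (T i)⁻¹), ⟨hk, ?_⟩,
    hl.conj T hT, ?_⟩
  · refine ⟨diagonal T * (l⁻¹ * (diagonal D * l1 * diagonal (fun i => (D i)⁻¹))) *
      diagonal (fun i => (T i)⁻¹), diagonal T * (diagonal D * u1),
      (hl.inv.mul (hl1.conj D hD)).conj T hT, ⟨fun i => ?_, fun i j h => ?_⟩, ?_⟩
    · have : (diagonal T * (diagonal D * u1)) i i = (t i : ℂ) := by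
        simp [Matrix.diagonal_mul, D, T, hu1i]
      rw [this]
      exact ⟨by simpa using ht i, by simp⟩
    · simp [Matrix.diagonal_mul, hu1 i j h]
    · calc diagonal T * G = diagonal T * (l⁻¹ * (diagonal D * (l1 * u1))) := by
            rw [hGA, ← hlu]
        _ = diagonal T * (l⁻¹ * (diagonal D * (l1 *
              ((diagonal (fun i => (D i)⁻¹) * ((diagonal (fun i => (T i)⁻¹) * diagonal T) *
                diagonal D)) * u1)))) := by
            rw [e1, Matrix.one_mul, e2, Matrix.one_mul]
        _ = diagonal T * (l⁻¹ * (diagonal D * (l1 *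
              ((diagonal (fun i => (D i)⁻¹) * diagonal (fun i => (T i)⁻¹)) * (diagonal T *
                diagonal D) * u1)))) := by
            simp only [Matrix.mul_assoc]
        _ = _ := by
            simp only [Matrix.mul_assoc]
  · rw [hlk]
    have hW : IsUnit (diagonal T * A).det := by
      rw [Matrix.det_mul]; exact (mul_ne_zero (hdd T hT) hA).isUnit
    have hPD : permMat σ⁻¹ * diagonal d * (permMat σ⁻¹)⁻¹ = diagonal (fun i => d (σ i)) := by
      rw [permMat_mul_diag, Matrix.mul_assoc, Matrix.mul_nonsing_inv _ hP, Matrix.mul_one]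
    have key : diagonal T * A * (g * diagonal d * g⁻¹) =
        diagonal (fun i => d (σ i)) * (diagonal T * A) := by
      calc diagonal T * A * (g * diagonal d * g⁻¹)
          = diagonal T * (diagonal D * (permMat σ⁻¹ * ((g⁻¹ * g) * (diagonal d * g⁻¹)))) := by
            simp only [A, Matrix.mul_assoc]
        _ = (diagonal T * diagonal D) * ((permMat σ⁻¹ * diagonal d) * g⁻¹) := by
            rw [Matrix.nonsing_inv_mul g hgd]; simp only [Matrix.one_mul, Matrix.mul_assoc]
        _ = ((diagonal T * diagonal D) * diagonal (fun i => d (σ i))) *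
              (permMat σ⁻¹ * g⁻¹) := by
            rw [permMat_mul_diag]; simp only [Matrix.mul_assoc]
        _ = (diagonal (fun i => d (σ i)) * (diagonal T * diagonal D)) *
              (permMat σ⁻¹ * g⁻¹) := by
            simp only [Matrix.diagonal_mul_diagonal]
            congr 2; ext i; ring
        _ = _ := by simp only [A, Matrix.mul_assoc]
    rw [hPD, Matrix.mul_assoc (diagonal T * A)⁻¹, ← key, ← Matrix.mul_assoc, Matrix.nonsing_inv_mul _ hW,
      Matrix.one_mul]
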